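/- Main theorem (annulus): Let M = {R₀ ≤ |x| ≤ R₂} ⊂ ℝ², S = {|x| = R₁} with 0 < R₀ < R₁ < R₂, and c = c₋ on R₀<|x|<R₁, c = c₊ on R₁<|x|<R₂, with 0 < c₋ < c₊ and c₋/R₁² < c₊/R₂². Then there exist sequences λ_n ∈ ℝ and u_n in the domain A of the Friedrichs extension of −div(c∇·) (Dirichlet boundary conditions, transmission conditions on S) such that −div(c∇u_n) = λ_n u_n, λ_n/n² → E₀ := c₋/R₁², ‖u_n‖_{L²(M)} = 1, and for every compact ω ⊂ M with dist(ω,S) > 0 there are C, d > 0 with ‖u_n‖_{L²(ω)} ≤ C e^{−dn} for all n. -/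

import Mathlib

open Set Filter MeasureTheory

lemma aux_sinsq (x y : ℝ) : |Real.sin x ^ 2 - Real.sin y ^ 2| ≤ 2 * |x - y| := by
  have h1 : |Real.sin x - Real.sin y| ≤ |x - y| := by
    have := Real.lipschitzWith_sin.dist_le_mul x y
    simpa [Real.dist_eq] using this
  have h2 : |Real.sin x + Real.sin y| ≤ 2 := by
    have := abs_add_le (Real.sin x) (Real.sin y)
    have := Real.abs_sin_le_one x
    have := Real.abs_sin_le_one y
    linarith
  have : Real.sin x ^ 2 - Real.sin y ^ 2 = (Real.sin x + Real.sin y) * (Real.sin x - Real.sin y) := by ring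
  rw [this, abs_mul]
  exact mul_le_mul h2 h1 (abs_nonneg _) (by norm_num)

lemma aux_field_lip {A B M : ℝ} (hA : |A| ≤ M) (hB : |B| ≤ M) (x y : ℝ) :
    |(A * Real.cos x ^ 2 + B * Real.sin x ^ 2) - (A * Real.cos y ^ 2 + B * Real.sin y ^ 2)|
      ≤ 4 * M * |x - y| := by
  have e : (A * Real.cos x ^ 2 + B * Real.sin x ^ 2) - (A * Real.cos y ^ 2 + B * Real.sin y ^ 2)
      = (B - A) * (Real.sin x ^ 2 - Real.sin y ^ 2) := by
    rw [Real.cos_sq', Real.cos_sq']; ring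
  rw [e, abs_mul]
  have h1 : |B - A| ≤ 2 * M := by
    have := abs_sub B A
    linarith
  have h2 := aux_sinsq x y
  have := mul_le_mul h1 h2 (abs_nonneg _) (by linarith [abs_nonneg A])
  linarith

lemma aux_field_bd {A B M : ℝ} (hA : |A| ≤ M) (hB : |B| ≤ M) (x : ℝ) :
    |A * Real.cos x ^ 2 + B * Real.sin x ^ 2| ≤ M := by
  have h := Real.sin_sq_add_cos_sq x
  have hs := sq_nonneg (Real.sin x)
  have hc := sq_nonneg (Real.cos x)
  rw [abs_le] at *
  constructor <;> nlinarith

lemma prufer_exists {a b M : ℝ} (A B : ℝ → ℝ)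
    (hA : ContinuousOn A (Icc a b)) (hB : ContinuousOn B (Icc a b))
    (hAM : ∀ t ∈ Icc a b, |A t| ≤ M) (hBM : ∀ t ∈ Icc a b, |B t| ≤ M)
    (t0 : ℝ) (ht0 : t0 ∈ Icc a b) (θ0 : ℝ) :
    ∃ θ : ℝ → ℝ, θ t0 = θ0 ∧ ∀ t ∈ Icc a b,
      HasDerivWithinAt θ (A t * Real.cos (θ t) ^ 2 + B t * Real.sin (θ t) ^ 2) (Icc a b) t := by
  have hM : 0 ≤ M := (abs_nonneg _).trans (hAM t0 ht0)
  have hba : 0 ≤ b - a := by linarith [ht0.1, ht0.2]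
  have key : IsPicardLindelof (fun t x => A t * Real.cos x ^ 2 + B t * Real.sin x ^ 2)
      (⟨t0, ht0⟩ : Icc a b) θ0 ⟨M * (b - a), by positivity⟩ 0 ⟨M, hM⟩ ⟨4 * M, by positivity⟩ := by
    refine ⟨?_, ?_, ?_, ?_⟩
    · intro t ht
      refine LipschitzOnWith.of_dist_le_mul fun x _ y _ => ?_
      simp only [Real.dist_eq]
      exact aux_field_lip (hAM t ht) (hBM t ht) x y
    · intro x _
      fun_prop
    · intro t ht x _
      exact aux_field_bd (hAM t ht) (hBM t ht) x
    · simp only [NNReal.coe_zero, sub_zero]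
      apply mul_le_mul_of_nonneg_left _ hM
      apply max_le <;> linarith [ht0.1, ht0.2]
  obtain ⟨θ, h1, h2⟩ := key.exists_eq_forall_mem_Icc_hasDerivWithinAt₀
  exact ⟨θ, h1, h2⟩

lemma hdwa_right {f : ℝ → ℝ} {f' a b t : ℝ} (h : HasDerivWithinAt f f' (Icc a b) t)
    (ht : t ∈ Ico a b) : HasDerivWithinAt f f' (Ici t) t := by
  refine (h.mono_of_mem_nhdsWithin ?_)
  have : Icc t b ∈ nhdsWithin t (Ici t) := Icc_mem_nhdsGE ht.2
  exact mem_of_superset this (Icc_subset_Icc_left ht.1)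

lemma prufer_dep {a b M ε : ℝ} {A B₁ B₂ θ₁ θ₂ : ℝ → ℝ} (hab : a ≤ b) (hM0 : 0 < M)
    (hAM : ∀ t ∈ Icc a b, |A t| ≤ M) (hBM : ∀ t ∈ Icc a b, |B₁ t| ≤ M)
    (hBB : ∀ t ∈ Icc a b, |B₂ t - B₁ t| ≤ ε)
    (h₁ : ∀ t ∈ Icc a b,
      HasDerivWithinAt θ₁ (A t * Real.cos (θ₁ t) ^ 2 + B₁ t * Real.sin (θ₁ t) ^ 2) (Icc a b) t)
    (h₂ : ∀ t ∈ Icc a b,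
      HasDerivWithinAt θ₂ (A t * Real.cos (θ₂ t) ^ 2 + B₂ t * Real.sin (θ₂ t) ^ 2) (Icc a b) t) :
    |θ₁ b - θ₂ b| ≤ |θ₁ a - θ₂ a| * Real.exp (4 * M * (b - a))
      + ε / (4 * M) * (Real.exp (4 * M * (b - a)) - 1) := by
  have := dist_le_of_approx_trajectories_ODE_of_mem (E := ℝ) (a := a) (b := b)
    (K := ⟨4 * M, by positivity⟩) (f := θ₁) (g := θ₂) (εf := 0) (εg := ε)
    (δ := |θ₁ a - θ₂ a|) (s := fun _ => univ)
    (v := fun t x => A t * Real.cos x ^ 2 + B₁ t * Real.sin x ^ 2)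
    (fun t ht => ?_) (fun t ht => (h₁ t ht).continuousWithinAt)
    (fun t ht => hdwa_right (h₁ t (Ico_subset_Icc_self ht)) ht)
    (fun t ht => by simp) (fun _ _ => mem_univ _)
    (fun t ht => (h₂ t ht).continuousWithinAt)
    (fun t ht => hdwa_right (h₂ t (Ico_subset_Icc_self ht)) ht)
    (fun t ht => ?_) (fun _ _ => mem_univ _) (by simp [Real.dist_eq]) b (right_mem_Icc.2 hab)
  · have hK : 4 * M ≠ 0 := by positivity
    change dist (θ₁ b) (θ₂ b) ≤ gronwallBound _ (4 * M) _ _ at this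
    rw [gronwallBound_of_K_ne_0 hK] at this
    simpa [Real.dist_eq] using this
  · refine LipschitzOnWith.of_dist_le_mul fun x _ y _ => ?_
    simp only [Real.dist_eq]
    exact aux_field_lip (hAM t (Ico_subset_Icc_self ht)) (hBM t (Ico_subset_Icc_self ht)) x y
  · have h := hBB t (Ico_subset_Icc_self ht)
    rw [Real.dist_eq]
    have e : A t * Real.cos (θ₂ t) ^ 2 + B₂ t * Real.sin (θ₂ t) ^ 2 -
      (A t * Real.cos (θ₂ t) ^ 2 + B₁ t * Real.sin (θ₂ t) ^ 2)
      = (B₂ t - B₁ t) * Real.sin (θ₂ t) ^ 2 := by ring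
    rw [e, abs_mul]
    have hs : |Real.sin (θ₂ t) ^ 2| ≤ 1 := by
      rw [abs_of_nonneg (sq_nonneg _)]; exact Real.sin_sq_le_one _
    calc _ ≤ |B₂ t - B₁ t| * 1 := by gcongr
      _ ≤ ε := by linarith

/-- lower barrier at a multiple of `π` -/
lemma prufer_lower {a b : ℝ} {A B θ : ℝ → ℝ} (c : ℝ) (hc : Real.sin c = 0)
    (hA : ∀ t ∈ Icc a b, 0 < A t)
    (h : ∀ t ∈ Icc a b,
      HasDerivWithinAt θ (A t * Real.cos (θ t) ^ 2 + B t * Real.sin (θ t) ^ 2) (Icc a b) t)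
    (h0 : c ≤ θ a) : ∀ t ∈ Icc a b, c ≤ θ t := by
  intro t ht
  have := image_le_of_deriv_right_lt_deriv_boundary' (a := a) (b := b) (f := fun _ => c)
    (f' := fun _ => 0) (B := θ) (by fun_prop) (fun x _ => hasDerivWithinAt_const _ _ _) h0
    (fun t ht => (h t ht).continuousWithinAt)
    (fun t ht => hdwa_right (h t (Ico_subset_Icc_self ht)) ht) (fun x hx e => ?_) ht
  · exact this
  · rw [← e, hc]
    have h2 : Real.cos c ^ 2 = 1 := by rw [Real.cos_sq', hc]; norm_num
    rw [h2]
    simpa using hA x (Ico_subset_Icc_self hx)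

lemma prufer_upper {a b : ℝ} {A B θ : ℝ → ℝ}
    (hB : ∀ t ∈ Icc a b, B t < 0)
    (h : ∀ t ∈ Icc a b,
      HasDerivWithinAt θ (A t * Real.cos (θ t) ^ 2 + B t * Real.sin (θ t) ^ 2) (Icc a b) t)
    (h0 : θ a ≤ Real.pi / 2) : ∀ t ∈ Icc a b, θ t ≤ Real.pi / 2 := by
  intro t ht
  have := image_le_of_deriv_right_lt_deriv_boundary' (a := a) (b := b) (f := θ)
    (B := fun _ => Real.pi / 2)
    (B' := fun _ => 0) 
    (fun t ht => (h t ht).continuousWithinAt)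
    (fun t ht => hdwa_right (h t (Ico_subset_Icc_self ht)) ht) h0 (by fun_prop)
    (fun x _ => hasDerivWithinAt_const _ _ _) (fun x hx e => ?_) ht
  · exact this
  · rw [e]
    simpa using hB x (Ico_subset_Icc_self hx)

lemma prufer_gain {a b m : ℝ} {A B θ : ℝ → ℝ} (hab : a ≤ b)
    (hA : ∀ t ∈ Icc a b, m ≤ A t) (hB : ∀ t ∈ Icc a b, m ≤ B t)
    (h : ∀ t ∈ Icc a b,
      HasDerivWithinAt θ (A t * Real.cos (θ t) ^ 2 + B t * Real.sin (θ t) ^ 2) (Icc a b) t) :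
    θ a + m * (b - a) ≤ θ b := by
  have := image_le_of_deriv_right_le_deriv_boundary (a := a) (b := b)
    (f := fun t => θ a + m * (t - a)) (f' := fun _ => m) (B := θ) (by fun_prop) (fun x _ => ?_)
    (by simp)
    (fun t ht => (h t ht).continuousWithinAt)
    (fun t ht => hdwa_right (h t (Ico_subset_Icc_self ht)) ht) (fun x hx => ?_)
    (right_mem_Icc.2 hab)
  · exact this
  · have : HasDerivAt (fun t => θ a + m * (t - a)) (m * 1) x :=
      (((hasDerivAt_id x).sub_const a).const_mul m).const_add (θ a)
    simpa using this.hasDerivWithinAt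
  · have h1 := hA x (Ico_subset_Icc_self hx)
    have h2 := hB x (Ico_subset_Icc_self hx)
    have h := Real.sin_sq_add_cos_sq (θ x)
    have h3 := mul_le_mul_of_nonneg_right h1 (sq_nonneg (Real.cos (θ x)))
    have h4 := mul_le_mul_of_nonneg_right h2 (sq_nonneg (Real.sin (θ x)))
    have h5 : m * Real.cos (θ x) ^ 2 + m * Real.sin (θ x) ^ 2 = m := by
      rw [← mul_add, add_comm, h, mul_one]
    linarith

lemma prufer_amp {a b : ℝ} {A B θ : ℝ → ℝ}
    (hA : ContinuousOn A (Icc a b)) (hB : ContinuousOn B (Icc a b))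
    (h : ∀ t ∈ Icc a b,
      HasDerivWithinAt θ (A t * Real.cos (θ t) ^ 2 + B t * Real.sin (θ t) ^ 2) (Icc a b) t)
    (t0 : ℝ) (ht0 : t0 ∈ Ioo a b) :
    ∃ y w : ℝ → ℝ, y t0 = Real.sin (θ t0) ∧ w t0 = Real.cos (θ t0) ∧
      (∀ t ∈ Ioo a b, HasDerivAt y (A t * w t) t) ∧
      (∀ t ∈ Ioo a b, HasDerivAt w (- B t * y t) t) ∧
      (∀ t, Real.sin (θ t) = 0 → y t = 0) ∧ (∀ t, y t ≠ 0 ∨ w t ≠ 0) := by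
  set f : ℝ → ℝ := fun t => (A t - B t) * (Real.sin (θ t) * Real.cos (θ t)) with hf
  have hθ : ContinuousOn θ (Icc a b) := fun t ht => (h t ht).continuousWithinAt
  have hfc : ContinuousOn f (Icc a b) := by
    have h1 : ContinuousOn (fun t => Real.sin (θ t)) (Icc a b) :=
      Real.continuous_sin.comp_continuousOn hθ
    have h2 : ContinuousOn (fun t => Real.cos (θ t)) (Icc a b) :=
      Real.continuous_cos.comp_continuousOn hθ
    exact (hA.sub hB).mul (h1.mul h2)
  set g : ℝ → ℝ := fun t => ∫ x in t0..t, f x with hg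
  have hgd : ∀ t ∈ Ioo a b, HasDerivAt g (f t) t := by
    intro t ht
    refine intervalIntegral.integral_hasDerivAt_right ?_ ?_ ?_
    · apply ContinuousOn.intervalIntegrable
      apply hfc.mono
      exact (convex_Icc a b).ordConnected.uIcc_subset (Ioo_subset_Icc_self ht0)
        (Ioo_subset_Icc_self ht)
    · exact (hfc.mono Ioo_subset_Icc_self).stronglyMeasurableAtFilter isOpen_Ioo t ht
    · exact hfc.continuousAt (Icc_mem_nhds ht.1 ht.2)
  have hθd : ∀ t ∈ Ioo a b,
      HasDerivAt θ (A t * Real.cos (θ t) ^ 2 + B t * Real.sin (θ t) ^ 2) t :=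
    fun t ht => (h t (Ioo_subset_Icc_self ht)).hasDerivAt (Icc_mem_nhds ht.1 ht.2)
  refine ⟨fun t => Real.exp (g t) * Real.sin (θ t), fun t => Real.exp (g t) * Real.cos (θ t),
    by simp [hg], by simp [hg], ?_, ?_, ?_, ?_⟩
  · intro t ht
    have := (hgd t ht).exp.mul (hθd t ht).sin
    convert! this using 1
    have e := Real.sin_sq_add_cos_sq (θ t)
    simp only [hf]
    have e2 : Real.cos (θ t) ^ 2 = 1 - Real.sin (θ t) ^ 2 := by linarith
    rw [e2]
    linear_combination (-A t * Real.exp (g t) * Real.cos (θ t) * 0) * e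
  · intro t ht
    have := (hgd t ht).exp.mul (hθd t ht).cos
    convert! this using 1
    have e := Real.sin_sq_add_cos_sq (θ t)
    simp only [hf]
    linear_combination (B t * Real.exp (g t) * Real.sin (θ t)) * e
  · intro t ht; simp [ht]
  · intro t
    have e := Real.sin_sq_add_cos_sq (θ t)
    by_contra! hh
    have h1 : Real.sin (θ t) = 0 := by simpa using hh.1
    have h2 : Real.cos (θ t) = 0 := by simpa using hh.2
    rw [h1, h2] at e
    norm_num at e

lemma cutoff_ext {R₀ R₂ : ℝ} (hR₀ : 0 < R₀) (h02 : R₀ < R₂) {y : ℝ → ℝ}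
    (hy : ContDiffOn ℝ 2 y (Ioo (R₀ / 2) (R₂ + R₀ / 2))) :
    ∃ ψ : ℝ → ℝ, ContDiff ℝ 2 ψ ∧ ∀ r ∈ Icc R₀ R₂, ψ =ᶠ[nhds r] y := by
  let χ : ContDiffBump ((R₀ + R₂) / 2) :=
    ⟨(R₂ - R₀) / 2 + R₀ / 8, (R₂ - R₀) / 2 + R₀ / 4, by linarith, by linarith⟩
  refine ⟨fun r => χ r * y r, ?_, ?_⟩
  · rw [contDiff_iff_contDiffAt]
    intro x
    by_cases hx : x ∈ Ioo (R₀ / 2) (R₂ + R₀ / 2)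
    · exact χ.contDiff.contDiffAt.mul (hy.contDiffAt (Ioo_mem_nhds hx.1 hx.2))
    · have : (fun r => χ r * y r) =ᶠ[nhds x] fun _ => 0 := by
        have : ∀ᶠ r in nhds x, χ.rOut ≤ dist r ((R₀ + R₂) / 2) := by
          have hd : χ.rOut < dist x ((R₀ + R₂) / 2) := by
            rw [Real.dist_eq]
            change (R₂ - R₀) / 2 + R₀ / 4 < _
            rw [lt_abs]
            by_contra! hh
            exact hx ⟨by linarith, by linarith⟩
          have hc : Continuous fun r : ℝ => dist r ((R₀ + R₂) / 2) := by fun_prop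
          filter_upwards [hc.continuousAt.eventually (lt_mem_nhds hd)] with r hr using hr.le
        filter_upwards [this] with r hr
        rw [χ.zero_of_le_dist hr, zero_mul]
      exact contDiffAt_const.congr_of_eventuallyEq this
  · intro r hr
    have : r ∈ Metric.ball ((R₀ + R₂) / 2) χ.rIn := by
      rw [Metric.mem_ball, Real.dist_eq]
      change _ < (R₂ - R₀) / 2 + R₀ / 8
      rw [abs_lt]
      constructor <;> linarith [hr.1, hr.2]
    filter_upwards [χ.eventuallyEq_one_of_mem_ball this] with x hx
    rw [hx]; simp

/-- the radial solution built from a Prüfer angle -/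
lemma radial_sol {R₀ R₂ R₁ c K : ℝ} (hR₀ : 0 < R₀) (h01 : R₀ < R₁) (h12 : R₁ < R₂)
    (hc : 0 < c) (hK : 0 < K)
    {q θ : ℝ → ℝ} (hq : Continuous q)
    (h : ∀ t ∈ Icc (R₀ / 2) (R₂ + R₀ / 2),
      HasDerivWithinAt θ (K / (c * t) * Real.cos (θ t) ^ 2
        + (- (c * q t / (t * K))) * Real.sin (θ t) ^ 2) (Icc (R₀ / 2) (R₂ + R₀ / 2)) t) :
    ∃ ψ w : ℝ → ℝ, ContDiff ℝ 2 ψ ∧ ψ R₁ = Real.sin (θ R₁) ∧ w R₁ = Real.cos (θ R₁) ∧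
      (∀ r ∈ Icc R₀ R₂, deriv ψ r = K / (c * r) * w r) ∧
      (∀ r ∈ Icc R₀ R₂, deriv (deriv ψ) r + (1 / r) * deriv ψ r = q r / r ^ 2 * ψ r) ∧
      (∀ r ∈ Icc R₀ R₂, Real.sin (θ r) = 0 → ψ r = 0) ∧
      (∀ r ∈ Icc R₀ R₂, ψ r ≠ 0 ∨ w r ≠ 0) := by
  have hpos : ∀ t ∈ Icc (R₀ / 2) (R₂ + R₀ / 2), 0 < t := fun t ht => by linarith [ht.1]
  have hA : ContinuousOn (fun t => K / (c * t)) (Icc (R₀ / 2) (R₂ + R₀ / 2)) := by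
    apply ContinuousOn.div (by fun_prop) (by fun_prop)
    intro t ht
    have := hpos t ht
    positivity
  have hB : ContinuousOn (fun t => - (c * q t / (t * K))) (Icc (R₀ / 2) (R₂ + R₀ / 2)) := by
    apply ContinuousOn.neg
    apply ContinuousOn.div (by fun_prop) (by fun_prop)
    intro t ht
    have := hpos t ht
    positivity
  have hR1 : R₁ ∈ Ioo (R₀ / 2) (R₂ + R₀ / 2) := ⟨by linarith, by linarith⟩
  obtain ⟨y, w, hy1, hw1, hyd, hwd, hz, hnv⟩ := prufer_amp hA hB h R₁ hR1
  have hyc : ContinuousOn y (Ioo (R₀ / 2) (R₂ + R₀ / 2)) :=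
    fun t ht => (hyd t ht).continuousAt.continuousWithinAt
  have hwC1 : ContDiffOn ℝ 1 w (Ioo (R₀ / 2) (R₂ + R₀ / 2)) := by
    rw [show (1 : WithTop ℕ∞) = 0 + 1 from rfl, contDiffOn_succ_iff_deriv_of_isOpen isOpen_Ioo]
    refine ⟨fun t ht => (hwd t ht).differentiableAt.differentiableWithinAt, by simp, ?_⟩
    rw [contDiffOn_zero]
    have : ContinuousOn (fun t => - (- (c * q t / (t * K))) * y t)
        (Ioo (R₀ / 2) (R₂ + R₀ / 2)) := ((hB.mono Ioo_subset_Icc_self).neg).mul hyc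
    exact this.congr fun t ht => (hwd t ht).deriv
  have hyC2 : ContDiffOn ℝ 2 y (Ioo (R₀ / 2) (R₂ + R₀ / 2)) := by
    rw [show (2 : WithTop ℕ∞) = 1 + 1 from (one_add_one_eq_two).symm,
      contDiffOn_succ_iff_deriv_of_isOpen isOpen_Ioo]
    refine ⟨fun t ht => (hyd t ht).differentiableAt.differentiableWithinAt, by simp, ?_⟩
    have : ContDiffOn ℝ 1 (fun t => K / (c * t) * w t)
        (Ioo (R₀ / 2) (R₂ + R₀ / 2)) := by
      refine ContDiffOn.mul (ContDiffOn.div contDiffOn_const (by fun_prop) ?_) hwC1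
      intro t ht
      have := hpos t (Ioo_subset_Icc_self ht)
      positivity
    exact this.congr fun t ht => (hyd t ht).deriv
  obtain ⟨ψ, hψ, hψy⟩ := cutoff_ext hR₀ (h01.trans h12) hyC2
  have hsub : ∀ r ∈ Icc R₀ R₂, r ∈ Ioo (R₀ / 2) (R₂ + R₀ / 2) :=
    fun r hr => ⟨by linarith [hr.1], by linarith [hr.2]⟩
  have hd1 : ∀ r ∈ Icc R₀ R₂, deriv ψ r = K / (c * r) * w r := fun r hr => by
    rw [(hψy r hr).deriv_eq, (hyd r (hsub r hr)).deriv]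
  refine ⟨ψ, w, hψ, ?_, hw1, hd1, ?_, ?_, fun r hr => ?_⟩
  · rw [(hψy R₁ ⟨h01.le, h12.le⟩).eq_of_nhds, hy1]
  · intro r hr
    have hr0 : 0 < r := by linarith [hr.1]
    have e1 : deriv ψ =ᶠ[nhds r] fun t => K / (c * t) * w t := by
      filter_upwards [(hψy r hr).deriv, Ioo_mem_nhds (hsub r hr).1 (hsub r hr).2] with t ht ht'
      rw [ht, (hyd t ht').deriv]
    have e2 : HasDerivAt (fun t => K / (c * t) * w t)
        (-(K * c) / (c * r) ^ 2 * w r + K / (c * r) * (-(- (c * q r / (r * K))) * y r)) r := by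
      refine HasDerivAt.mul ?_ (hwd r (hsub r hr))
      have := (hasDerivAt_const r K).div ((hasDerivAt_id r).const_mul c) (by simpa using ⟨hc.ne', hr0.ne'⟩)
      convert! this using 1
      simp
    rw [e1.deriv_eq, e2.deriv, hd1 r hr, (hψy r hr).eq_of_nhds]
    field_simp
    ring
  · intro r hr hs
    rw [(hψy r hr).eq_of_nhds, hz r hs]
  · rw [(hψy r hr).eq_of_nhds]; exact hnv r

/-- the Prüfer equation of one piece -/
def PEq (R₀ R₂ c c' K ν l : ℝ) (θ : ℝ → ℝ) : Prop :=
  ∀ t ∈ Icc (R₀ / 2) (R₂ + R₀ / 2),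
      HasDerivWithinAt θ (K / (c * t) * Real.cos (θ t) ^ 2
        + (- (c * (ν ^ 2 - l * t ^ 2 / c') / (t * K))) * Real.sin (θ t) ^ 2)
        (Icc (R₀ / 2) (R₂ + R₀ / 2)) t

lemma piece_shoot {R₀ R₂ c c' K ν l₀ l₁ : ℝ} (hR₀ : 0 < R₀)
    (hc : 0 < c) (hc' : 0 < c') (hK : 0 < K) (t0 t1 : ℝ) (h0 : R₀ ≤ t0) (h01 : t0 < t1)
    (h1 : t1 ≤ R₂) :
    ∃ L : ℝ, ∃ θ : ℝ → ℝ → ℝ → ℝ, 0 ≤ L ∧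
      (∀ l x, θ l x t0 = x ∧ PEq R₀ R₂ c c' K ν l (θ l x)) ∧
      ∀ l ∈ Icc l₀ l₁, ∀ l' ∈ Icc l₀ l₁, ∀ x x',
        |θ l x t1 - θ l' x' t1| ≤ L * (|l - l'| + |x - x'|) := by
  have hpos : ∀ t ∈ Icc (R₀ / 2) (R₂ + R₀ / 2), 0 < t := fun t ht => by linarith [ht.1]
  have hA : ContinuousOn (fun t => K / (c * t)) (Icc (R₀ / 2) (R₂ + R₀ / 2)) := by
    apply ContinuousOn.div (by fun_prop) (by fun_prop)
    intro t ht
    have := hpos t ht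
    positivity
  have hB : ∀ l : ℝ, ContinuousOn (fun t => - (c * (ν ^ 2 - l * t ^ 2 / c') / (t * K)))
      (Icc (R₀ / 2) (R₂ + R₀ / 2)) := by
    intro l
    apply ContinuousOn.neg
    apply ContinuousOn.div (by fun_prop) (by fun_prop)
    intro t ht
    have := hpos t ht
    positivity
  have ht0 : t0 ∈ Icc (R₀ / 2) (R₂ + R₀ / 2) := ⟨by linarith, by linarith⟩
  have hex : ∀ l x : ℝ, ∃ θ : ℝ → ℝ, θ t0 = x ∧ PEq R₀ R₂ c c' K ν l θ := by
    intro l x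
    obtain ⟨M1, hM1⟩ := isCompact_Icc.exists_bound_of_continuousOn hA
    obtain ⟨M2, hM2⟩ := isCompact_Icc.exists_bound_of_continuousOn (hB l)
    exact prufer_exists (M := max M1 M2) _ _ hA (hB l)
      (fun t ht => (hM1 t ht).trans (le_max_left _ _))
      (fun t ht => (hM2 t ht).trans (le_max_right _ _)) t0 ht0 x
  choose θ hθ0 hθ using hex
  obtain ⟨M1, hM1⟩ := isCompact_Icc.exists_bound_of_continuousOn hA
  have hBB : ContinuousOn (fun p : ℝ × ℝ => - (c * (ν ^ 2 - p.1 * p.2 ^ 2 / c') / (p.2 * K)))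
      (Icc l₀ l₁ ×ˢ Icc (R₀ / 2) (R₂ + R₀ / 2)) := by
    apply ContinuousOn.neg
    apply ContinuousOn.div (by fun_prop) (by fun_prop)
    intro t ht
    have := hpos t.2 ht.2
    positivity
  obtain ⟨M2, hM2⟩ := (isCompact_Icc.prod isCompact_Icc).exists_bound_of_continuousOn hBB
  set M := max 1 (max M1 M2) with hM
  have hMpos : 0 < M := lt_of_lt_of_le one_pos (le_max_left _ _)
  set D := c * t1 / (c' * K) with hD
  have ht1pos : 0 < t1 := by linarith
  have hDpos : 0 ≤ D := by positivity
  have hsub : Icc t0 t1 ⊆ Icc (R₀ / 2) (R₂ + R₀ / 2) :=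
    Icc_subset_Icc (by linarith) (by linarith)
  set E := Real.exp (4 * M * (t1 - t0)) with hE
  have hE1 : 1 ≤ E := Real.one_le_exp (by
    have : 0 < t1 - t0 := by linarith
    positivity)
  have hL1 : 0 ≤ D / (4 * M) * (E - 1) := mul_nonneg (by positivity) (by linarith)
  refine ⟨E + D / (4 * M) * (E - 1), θ, by linarith, fun l x => ⟨hθ0 l x, hθ l x⟩, ?_⟩
  intro l hl l' hl' x x'
  have := prufer_dep (a := t0) (b := t1) (M := M) (ε := D * |l - l'|)
    (A := fun t => K / (c * t))
    (B₁ := fun t => - (c * (ν ^ 2 - l * t ^ 2 / c') / (t * K)))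
    (B₂ := fun t => - (c * (ν ^ 2 - l' * t ^ 2 / c') / (t * K)))
    (θ₁ := θ l x) (θ₂ := θ l' x') h01.le hMpos
    (fun t ht => (hM1 t (hsub ht)).trans ((le_max_left _ _).trans (le_max_right _ _)))
    (fun t ht => (hM2 (l, t) ⟨hl, hsub ht⟩).trans ((le_max_right _ _).trans (le_max_right _ _)))
    (fun t ht => ?_) (fun t ht => (hθ l x t (hsub ht)).mono hsub)
    (fun t ht => (hθ l' x' t (hsub ht)).mono hsub)
  · rw [hθ0, hθ0] at this
    refine this.trans ?_
    have e : D * |l - l'| / (4 * M) * (E - 1) = (D / (4 * M) * (E - 1)) * |l - l'| := by ring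
    rw [e]
    nlinarith [abs_nonneg (l - l'), abs_nonneg (x - x'),
      mul_nonneg hL1 (abs_nonneg (x - x')), mul_nonneg (by linarith : 0 ≤ E) (abs_nonneg (l - l'))]
  · have htp : 0 < t := hpos t (hsub ht)
    have e : - (c * (ν ^ 2 - l' * t ^ 2 / c') / (t * K)) - - (c * (ν ^ 2 - l * t ^ 2 / c') / (t * K))
      = (c * t / (c' * K)) * (l' - l) := by
      field_simp; ring
    simp only [e]
    rw [abs_mul, abs_sub_comm l' l, abs_of_nonneg (by positivity)]
    apply mul_le_mul_of_nonneg_right _ (abs_nonneg _)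
    rw [hD]
    have := ht.2
    gcongr

/-- radial eigenfunction -/
def EigP (R₀ R₁ R₂ cm cp : ℝ) (n : ℕ) (lam : ℝ) (f g : ℝ → ℝ) : Prop :=
  ContDiff ℝ 2 f ∧ ContDiff ℝ 2 g ∧ f R₀ = 0 ∧ g R₂ = 0 ∧ f R₁ = g R₁ ∧
  cp * deriv f R₁ = cm * deriv g R₁ ∧
  (∀ r ∈ Ioo R₀ R₁,
          -cm * (deriv (deriv f) r + (1 / r) * deriv f r) +
            (cm * (n : ℝ) ^ 2 / r ^ 2) * f r = lam * f r) ∧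
  (∀ r ∈ Ioo R₁ R₂,
          -cp * (deriv (deriv g) r + (1 / r) * deriv g r) +
            (cp * (n : ℝ) ^ 2 / r ^ 2) * g r = lam * g r) ∧
  ∃ r ∈ Ioo R₀ R₁, f r ≠ 0

lemma eigen_exists {R₀ R₁ R₂ cm cp : ℝ}
    (hR₀ : 0 < R₀) (hR₀₁ : R₀ < R₁) (hR₁₂ : R₁ < R₂)
    (hcm : 0 < cm) (hcp : 0 < cp)
    (hjump : cm / R₁ ^ 2 < cp / R₂ ^ 2) (n : ℕ) (L K s : ℝ) (hK : 0 < K)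
    (hs0 : R₀ ≤ s) (hs1 : s < R₁) (hL : cm / R₁ ^ 2 * (n : ℝ) ^ 2 - 1 ≤ L)
    (hq : ∀ r ∈ Icc s R₁, K ^ 2 ≤ cp ^ 2 * (L * r ^ 2 / cm - (n : ℝ) ^ 2))
    (hgain : Real.pi * (cp * R₁) ≤ K * (R₁ - s)) :
    ∃ l ∈ Icc (cm / R₁ ^ 2 * (n : ℝ) ^ 2 - 1) L, ∃ f g, EigP R₀ R₁ R₂ cm cp n l f g := by
  have hR₁ : 0 < R₁ := by linarith
  have hR₂ : 0 < R₂ := by linarith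
  set l₀ := cm / R₁ ^ 2 * (n : ℝ) ^ 2 - 1 with hl₀
  obtain ⟨L1, θ, hL1, hθ, hθL⟩ := piece_shoot (R₂ := R₂) (ν := (n : ℝ)) (l₀ := l₀) (l₁ := L)
    hR₀ hcp hcm hK R₀ R₁ le_rfl hR₀₁ hR₁₂.le
  obtain ⟨L2, φ, hL2, hφ, hφL⟩ := piece_shoot (R₂ := R₂) (ν := (n : ℝ)) (l₀ := l₀) (l₁ := L)
    hR₀ hcm hcp hK R₁ R₂ hR₀₁.le hR₁₂ le_rfl
  have hsub1 : Icc R₀ R₁ ⊆ Icc (R₀ / 2) (R₂ + R₀ / 2) :=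
    Icc_subset_Icc (by linarith) (by linarith)
  have hsub2 : Icc R₁ R₂ ⊆ Icc (R₀ / 2) (R₂ + R₀ / 2) :=
    Icc_subset_Icc (by linarith) (by linarith)
  have hsub3 : Icc s R₁ ⊆ Icc (R₀ / 2) (R₂ + R₀ / 2) :=
    Icc_subset_Icc (by linarith) (by linarith)
  set F : ℝ → ℝ := fun l => φ l (θ l 0 R₁) R₂ with hF
  have hFc : ContinuousOn F (Icc l₀ L) := by
    have : LipschitzOnWith ⟨L2 * (1 + L1), by positivity⟩ F (Icc l₀ L) := by
      refine LipschitzOnWith.of_dist_le_mul fun l hl l' hl' => ?_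
      rw [Real.dist_eq, Real.dist_eq]
      change _ ≤ (L2 * (1 + L1)) * _
      have h1 := hθL l hl l' hl' 0 0
      have h2 := hφL l hl l' hl' (θ l 0 R₁) (θ l' 0 R₁)
      simp only [sub_self, abs_zero, add_zero] at h1
      refine h2.trans ?_
      rw [mul_assoc]
      apply mul_le_mul_of_nonneg_left _ hL2
      linarith
    exact this.continuousOn
  have hpi := Real.pi_pos
  -- low end
  have hlow : F l₀ ≤ Real.pi := by
    have hB1 : ∀ t ∈ Icc R₀ R₁,
        - (cp * ((n : ℝ) ^ 2 - l₀ * t ^ 2 / cm) / (t * K)) < 0 := by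
      intro t ht
      have ht0 : 0 < t := by linarith [ht.1]
      have : 0 < (n : ℝ) ^ 2 - l₀ * t ^ 2 / cm := by
        rw [sub_pos, div_lt_iff₀ hcm, hl₀]
        have h1 : cm / R₁ ^ 2 * (n : ℝ) ^ 2 * t ^ 2 ≤ (n : ℝ) ^ 2 * cm := by
          have h2 : t ^ 2 ≤ R₁ ^ 2 := by
            have := ht.2
            gcongr
          calc cm / R₁ ^ 2 * (n : ℝ) ^ 2 * t ^ 2 ≤ cm / R₁ ^ 2 * (n : ℝ) ^ 2 * R₁ ^ 2 := by gcongr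
            _ = (n : ℝ) ^ 2 * cm := by field_simp
        nlinarith [pow_pos ht0 2]
      have : 0 < cp * ((n : ℝ) ^ 2 - l₀ * t ^ 2 / cm) / (t * K) := by positivity
      linarith
    have hB2 : ∀ t ∈ Icc R₁ R₂,
        - (cm * ((n : ℝ) ^ 2 - l₀ * t ^ 2 / cp) / (t * K)) < 0 := by
      intro t ht
      have ht0 : 0 < t := by linarith [ht.1]
      have : 0 < (n : ℝ) ^ 2 - l₀ * t ^ 2 / cp := by
        rw [sub_pos, div_lt_iff₀ hcp, hl₀]
        have h1 : cm / R₁ ^ 2 * (n : ℝ) ^ 2 * t ^ 2 ≤ (n : ℝ) ^ 2 * cp := by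
          have h2 : t ^ 2 ≤ R₂ ^ 2 := by
            have := ht.2
            gcongr
          calc cm / R₁ ^ 2 * (n : ℝ) ^ 2 * t ^ 2 ≤ cp / R₂ ^ 2 * (n : ℝ) ^ 2 * R₂ ^ 2 := by gcongr
            _ = (n : ℝ) ^ 2 * cp := by field_simp
        nlinarith [pow_pos ht0 2]
      have : 0 < cm * ((n : ℝ) ^ 2 - l₀ * t ^ 2 / cp) / (t * K) := by positivity
      linarith
    have h1 := prufer_upper hB1 (fun t ht => ((hθ l₀ 0).2 t (hsub1 ht)).mono hsub1)
      (by rw [(hθ l₀ 0).1]; positivity) R₁ (right_mem_Icc.2 hR₀₁.le)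
    have h2 := prufer_upper hB2 (fun t ht => ((hφ l₀ (θ l₀ 0 R₁)).2 t (hsub2 ht)).mono hsub2)
      (by rw [(hφ l₀ _).1]; exact h1) R₂ (right_mem_Icc.2 hR₁₂.le)
    simp only [hF]
    linarith
  have hhigh : Real.pi ≤ F L := by
    have h1 := prufer_lower 0 (by simp) (A := fun t => K / (cp * t)) (a := R₀) (b := R₁)
      (fun t ht => by have : 0 < t := by linarith [ht.1]
                      positivity) (fun t ht => ((hθ L 0).2 t (hsub1 ht)).mono hsub1)
      (by rw [(hθ L 0).1]) s ⟨hs0, hs1.le⟩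
    have h2 := prufer_gain (m := K / (cp * R₁)) (A := fun t => K / (cp * t)) (a := s) (b := R₁) hs1.le
      (fun t ht => by
        have : 0 < t := by linarith [ht.1]
        have := ht.2
        gcongr) (fun t ht => ?_) (fun t ht => ((hθ L 0).2 t (hsub3 ht)).mono hsub3)
    · have h3 : Real.pi ≤ K / (cp * R₁) * (R₁ - s) := by
        rw [div_mul_eq_mul_div, le_div_iff₀ (by positivity)]
        exact hgain
      have h4 := prufer_lower Real.pi (by simp) (A := fun t => K / (cm * t)) (a := R₁) (b := R₂)
        (fun t ht => by have : 0 < t := by linarith [ht.1]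
                        positivity)
        (fun t ht => ((hφ L (θ L 0 R₁)).2 t (hsub2 ht)).mono hsub2)
        (by rw [(hφ L _).1]; linarith) R₂ (right_mem_Icc.2 hR₁₂.le)
      exact h4
    · have ht0 : 0 < t := by linarith [ht.1]
      have h3 := hq t ht
      have e : -(cp * ((n : ℝ) ^ 2 - L * t ^ 2 / cm) / (t * K))
        = (cp ^ 2 * (L * t ^ 2 / cm - (n : ℝ) ^ 2)) / (cp * t * K) := by
        field_simp; ring
      rw [e, le_div_iff₀ (by positivity)]
      refine le_trans ?_ h3
      have h4 : K / (cp * R₁) * (cp * t * K) = K ^ 2 * (t / R₁) := by field_simp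
      rw [h4]
      have h5 : t / R₁ ≤ 1 := by rw [div_le_one hR₁]; exact ht.2
      nlinarith [pow_pos hK 2]
  obtain ⟨l, hl, hFl⟩ := intermediate_value_Icc hL hFc ⟨hlow, hhigh⟩
  refine ⟨l, hl, ?_⟩
  obtain ⟨f, w, hf, hf1, hw1, hfd, hfode, hfz, hfnv⟩ := radial_sol hR₀ hR₀₁ hR₁₂ hcp hK
    (q := fun t => (n : ℝ) ^ 2 - l * t ^ 2 / cm) (by fun_prop) (hθ l 0).2
  obtain ⟨g, v, hg, hg1, hv1, hgd, hgode, hgz, hgnv⟩ := radial_sol hR₀ hR₀₁ hR₁₂ hcm hK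
    (q := fun t => (n : ℝ) ^ 2 - l * t ^ 2 / cp) (by fun_prop) (hφ l (θ l 0 R₁)).2
  rw [(hφ l _).1] at hg1 hv1
  refine ⟨f, g, hf, hg, ?_, ?_, ?_, ?_, ?_, ?_, ?_⟩
  · exact hfz R₀ ⟨le_rfl, by linarith⟩ (by rw [(hθ l 0).1]; simp)
  · refine hgz R₂ ⟨by linarith, le_rfl⟩ ?_
    have : φ l (θ l 0 R₁) R₂ = Real.pi := hFl
    rw [this]; simp
  · rw [hf1, hg1]
  · rw [hfd R₁ ⟨hR₀₁.le, hR₁₂.le⟩, hgd R₁ ⟨hR₀₁.le, hR₁₂.le⟩, hw1, hv1]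
    field_simp
  · intro r hr
    have hr0 : 0 < r := by linarith [hr.1]
    rw [hfode r ⟨hr.1.le, by linarith [hr.2]⟩]
    field_simp
    ring
  · intro r hr
    have hr0 : 0 < r := by linarith [hr.1]
    rw [hgode r ⟨by linarith [hr.1], by linarith [hr.2]⟩]
    field_simp
    ring
  · by_contra! hz
    have hm : (R₀ + R₁) / 2 ∈ Ioo R₀ R₁ := ⟨by linarith, by linarith⟩
    have hm' : (R₀ + R₁) / 2 ∈ Icc R₀ R₂ := ⟨by linarith, by linarith⟩
    have h1 : f =ᶠ[nhds ((R₀ + R₁) / 2)] fun _ => 0 := by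
      filter_upwards [Ioo_mem_nhds hm.1 hm.2] with r hr using hz r hr
    have h2 := h1.deriv_eq
    rw [hfd _ hm', deriv_const] at h2
    have h3 : 0 < K / (cp * ((R₀ + R₁) / 2)) := by positivity
    rcases hfnv _ hm' with h | h
    · exact h (hz _ hm)
    · rcases mul_eq_zero.1 h2 with h4 | h4
      · exact h3.ne' h4
      · exact h h4

lemma le_of_sq_le_sq_aux {x y : ℝ} (h : x ^ 2 ≤ y ^ 2) (hy : 0 ≤ y) : x ≤ y :=
  le_of_abs_le ((sq_le_sq.1 h).trans_eq (abs_of_nonneg hy))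

lemma eigen_all {R₀ R₁ R₂ cm cp : ℝ}
    (hR₀ : 0 < R₀) (hR₀₁ : R₀ < R₁) (hR₁₂ : R₁ < R₂)
    (hcm : 0 < cm) (hcp : 0 < cp)
    (hjump : cm / R₁ ^ 2 < cp / R₂ ^ 2) (n : ℕ) :
    ∃ l, cm / R₁ ^ 2 * (n : ℝ) ^ 2 - 1 ≤ l ∧ ∃ f g, EigP R₀ R₁ R₂ cm cp n l f g := by
  have hR₁ : 0 < R₁ := by linarith
  have hpi := Real.pi_pos
  set s := (R₀ + R₁) / 2 with hs
  have hs0 : 0 < s := by linarith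
  have hd : 0 < R₁ - s := by linarith
  set K := Real.pi * (cp * R₁) / (R₁ - s) with hK
  have hKpos : 0 < K := by positivity
  set X := (K ^ 2 / cp ^ 2 + (n : ℝ) ^ 2) * cm / s ^ 2 with hX
  have hXpos : 0 ≤ X := by positivity
  have hE : 0 ≤ cm / R₁ ^ 2 * (n : ℝ) ^ 2 := by positivity
  have hq : ∀ r ∈ Icc s R₁, K ^ 2 ≤ cp ^ 2 * ((X + cm / R₁ ^ 2 * (n : ℝ) ^ 2) * r ^ 2 / cm - (n : ℝ) ^ 2) := by
    intro r hr
    have h1 : K ^ 2 / cp ^ 2 + (n : ℝ) ^ 2 ≤ (X + cm / R₁ ^ 2 * (n : ℝ) ^ 2) * r ^ 2 / cm := by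
      have h2 : K ^ 2 / cp ^ 2 + (n : ℝ) ^ 2 = X * s ^ 2 / cm := by
        rw [hX]; field_simp
      rw [h2]
      have := hr.1
      gcongr
      linarith
    have h3 : K ^ 2 / cp ^ 2 ≤ (X + cm / R₁ ^ 2 * (n : ℝ) ^ 2) * r ^ 2 / cm - (n : ℝ) ^ 2 := by
      linarith
    rw [div_le_iff₀ (by positivity)] at h3
    linarith
  obtain ⟨l, hl, h⟩ := eigen_exists hR₀ hR₀₁ hR₁₂ hcm hcp hjump n
    (X + cm / R₁ ^ 2 * (n : ℝ) ^ 2) K s hKpos (by linarith) (by linarith) (by linarith)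
    hq (by rw [hK]; field_simp; rfl)
  exact ⟨l, hl.1, h⟩

lemma eigen_large {R₀ R₁ R₂ cm cp : ℝ}
    (hR₀ : 0 < R₀) (hR₀₁ : R₀ < R₁) (hR₁₂ : R₁ < R₂)
    (hcm : 0 < cm) (hcp : 0 < cp)
    (hjump : cm / R₁ ^ 2 < cp / R₂ ^ 2) (δ : ℝ) (hδ : 0 < δ) :
    ∀ᶠ n : ℕ in atTop, ∃ l, cm / R₁ ^ 2 * (n : ℝ) ^ 2 - 1 ≤ l ∧
      l ≤ (n : ℝ) ^ 2 * (cm / R₁ ^ 2 + δ) ∧ ∃ f g, EigP R₀ R₁ R₂ cm cp n l f g := by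
  have hR₁ : 0 < R₁ := by linarith
  have hpi := Real.pi_pos
  set η := δ * R₁ ^ 2 / (2 * cm) with hη
  have hηpos : 0 < η := by positivity
  obtain ⟨s, hs0, hs1, hs2⟩ : ∃ s, R₀ ≤ s ∧ s < R₁ ∧ 1 + η ≤ (cm / R₁ ^ 2 + δ) * s ^ 2 / cm := by
    have hc : ContinuousAt (fun s : ℝ => (cm / R₁ ^ 2 + δ) * s ^ 2 / cm) R₁ := by fun_prop
    have hv : 1 + η < (cm / R₁ ^ 2 + δ) * R₁ ^ 2 / cm := by
      have : (cm / R₁ ^ 2 + δ) * R₁ ^ 2 / cm = 1 + 2 * η := by rw [hη]; field_simp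
      rw [this]; linarith
    have h1 := (hc.eventually (lt_mem_nhds hv)).filter_mono
      (nhdsWithin_le_nhds (s := Iio R₁))
    have h2 : ∀ᶠ s in nhdsWithin R₁ (Iio R₁), s ∈ Ioo R₀ R₁ := Ioo_mem_nhdsLT hR₀₁
    obtain ⟨s, ha, hb⟩ := (h1.and h2).exists
    exact ⟨s, hb.1.le, hb.2, ha.le⟩
  have hsq : 0 < Real.sqrt η := Real.sqrt_pos.2 hηpos
  have hd : 0 < R₁ - s := by linarith
  have hev : ∀ᶠ n : ℕ in atTop, Real.pi * (cp * R₁) / (cp * Real.sqrt η * (R₁ - s)) ≤ (n : ℝ) :=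
    tendsto_natCast_atTop_atTop.eventually_ge_atTop _
  filter_upwards [hev, eventually_gt_atTop 0] with n hn hn0
  have hn0' : (0 : ℝ) < n := by exact_mod_cast hn0
  rw [div_le_iff₀ (by positivity)] at hn
  have hq : ∀ r ∈ Icc s R₁, (cp * n * Real.sqrt η) ^ 2 ≤
      cp ^ 2 * ((n : ℝ) ^ 2 * (cm / R₁ ^ 2 + δ) * r ^ 2 / cm - (n : ℝ) ^ 2) := by
    intro r hr
    have h1 : 1 + η ≤ (cm / R₁ ^ 2 + δ) * r ^ 2 / cm := by
      refine hs2.trans ?_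
      have := hr.1
      have h0 : 0 ≤ s := by linarith
      gcongr
    have e1 : (cp * n * Real.sqrt η) ^ 2 = cp ^ 2 * ((n : ℝ) ^ 2 * η) := by
      rw [mul_pow, mul_pow, Real.sq_sqrt hηpos.le]; ring
    rw [e1]
    apply mul_le_mul_of_nonneg_left _ (by positivity)
    have e2 : (n : ℝ) ^ 2 * (cm / R₁ ^ 2 + δ) * r ^ 2 / cm
      = (n : ℝ) ^ 2 * ((cm / R₁ ^ 2 + δ) * r ^ 2 / cm) := by ring
    rw [e2]
    nlinarith [pow_pos hn0' 2]
  obtain ⟨l, hl, h⟩ := eigen_exists hR₀ hR₀₁ hR₁₂ hcm hcp hjump n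
    ((n : ℝ) ^ 2 * (cm / R₁ ^ 2 + δ)) (cp * n * Real.sqrt η) s (by positivity) hs0 hs1
    (by nlinarith [mul_pos (pow_pos hn0' 2) hδ]) hq (by linarith)
  exact ⟨l, hl.1, hl.2, h⟩

lemma eigen_seq {R₀ R₁ R₂ cm cp : ℝ}
    (hR₀ : 0 < R₀) (hR₀₁ : R₀ < R₁) (hR₁₂ : R₁ < R₂)
    (hcm : 0 < cm) (hcp : 0 < cp)
    (hjump : cm / R₁ ^ 2 < cp / R₂ ^ 2) :
    ∃ lam : ℕ → ℝ, (∀ n, ∃ f g, EigP R₀ R₁ R₂ cm cp n (lam n) f g) ∧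
      Tendsto (fun n : ℕ => lam n / (n : ℝ) ^ 2) atTop (nhds (cm / R₁ ^ 2)) := by
  set S : ℕ → Set ℝ := fun n => {l | cm / R₁ ^ 2 * (n : ℝ) ^ 2 - 1 ≤ l ∧
    ∃ f g, EigP R₀ R₁ R₂ cm cp n l f g} with hS
  have hne : ∀ n, (S n).Nonempty := fun n => eigen_all hR₀ hR₀₁ hR₁₂ hcm hcp hjump n
  have hbd : ∀ n, BddBelow (S n) := fun n => ⟨_, fun l hl => hl.1⟩
  have hch : ∀ n, ∃ l ∈ S n, l < sInf (S n) + 1 := fun n =>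
    exists_lt_of_csInf_lt (hne n) (by linarith)
  choose lam hlam hlt using hch
  refine ⟨lam, fun n => (hlam n).2, ?_⟩
  have hsqt : Tendsto (fun n : ℕ => (1 : ℝ) / (n : ℝ) ^ 2) atTop (nhds 0) := by
    have := tendsto_const_div_pow (1 : ℝ) 2 (by norm_num)
    exact this.comp tendsto_natCast_atTop_atTop
  rw [Metric.tendsto_nhds]
  intro ε hε
  filter_upwards [eigen_large hR₀ hR₀₁ hR₁₂ hcm hcp hjump (ε / 2) (by linarith),
    hsqt.eventually (gt_mem_nhds (show (0 : ℝ) < ε / 2 by linarith)),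
    eventually_gt_atTop 0] with n hn h1 hn0
  obtain ⟨l, hl1, hl2, hl3⟩ := hn
  have hn0' : (0 : ℝ) < n := by exact_mod_cast hn0
  have hn2 : (0 : ℝ) < (n : ℝ) ^ 2 := by positivity
  have h2 : sInf (S n) ≤ l := csInf_le (hbd n) ⟨hl1, hl3⟩
  have h3 := hlt n
  have h4 := (hlam n).1
  rw [div_lt_iff₀ hn2] at h1
  rw [Real.dist_eq, abs_lt]
  constructor
  · rw [neg_lt_sub_iff_lt_add, ← sub_lt_iff_lt_add', lt_div_iff₀ hn2]
    nlinarith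
  · rw [sub_lt_iff_lt_add, div_lt_iff₀ hn2]
    nlinarith

lemma decay_z {a b : ℝ} {y q : ℝ → ℝ} (ha : 0 < a) (hy : ContDiff ℝ 2 y)
    (hode : ∀ r ∈ Ioo a b, deriv (deriv y) r + (1 / r) * deriv y r = q r / r ^ 2 * y r) :
    Continuous (fun r => r * deriv y r) ∧
    (∀ r, HasDerivAt y (deriv y r) r) ∧
    ∀ r ∈ Ioo a b, HasDerivAt (fun r => r * deriv y r) (q r / r * y r) r := by
  have h1 : ContDiff ℝ 1 (deriv y) := by
    have : ContDiff ℝ (1 + 1) y := by rw [one_add_one_eq_two]; exact hy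
    exact (contDiff_succ_iff_deriv.1 this).2.2
  refine ⟨continuous_id.mul h1.continuous, fun r => (hy.differentiable (by norm_num) r).hasDerivAt,
    fun r hr => ?_⟩
  have hr0 : 0 < r := by linarith [hr.1]
  have := (hasDerivAt_id r).mul ((h1.differentiable (by norm_num) r).hasDerivAt)
  convert! this using 1
  have h2 := hode r hr
  simp only [id]
  have h3 : deriv (deriv y) r = q r / r ^ 2 * y r - (1 / r) * deriv y r := by linarith
  rw [h3]
  field_simp
  ring

lemma mono_of_hd {a b : ℝ} {f f' : ℝ → ℝ} (hf : Continuous f)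
    (hd : ∀ r ∈ Ioo a b, HasDerivAt f (f' r) r) (h0 : ∀ r ∈ Ioo a b, 0 ≤ f' r) :
    MonotoneOn f (Icc a b) := by
  apply monotoneOn_of_deriv_nonneg (convex_Icc a b) hf.continuousOn
  · intro r hr
    rw [interior_Icc] at hr
    exact (hd r hr).differentiableAt.differentiableWithinAt
  · intro r hr
    rw [interior_Icc] at hr
    rw [(hd r hr).deriv]; exact h0 r hr

lemma anti_of_hd {a b : ℝ} {f f' : ℝ → ℝ} (hf : Continuous f)
    (hd : ∀ r ∈ Ioo a b, HasDerivAt f (f' r) r) (h0 : ∀ r ∈ Ioo a b, f' r ≤ 0) :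
    AntitoneOn f (Icc a b) := by
  apply antitoneOn_of_deriv_nonpos (convex_Icc a b) hf.continuousOn
  · intro r hr
    rw [interior_Icc] at hr
    exact (hd r hr).differentiableAt.differentiableWithinAt
  · intro r hr
    rw [interior_Icc] at hr
    rw [(hd r hr).deriv]; exact h0 r hr

lemma decay_in {a b k : ℝ} {y q : ℝ → ℝ} (ha : 0 < a) (hab : a ≤ b) (hk : 0 ≤ k)
    (hy : ContDiff ℝ 2 y)
    (hode : ∀ r ∈ Ioo a b, deriv (deriv y) r + (1 / r) * deriv y r = q r / r ^ 2 * y r)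
    (hq : ∀ r ∈ Ioo a b, k ^ 2 ≤ q r) (h0 : y a = 0) :
    ∀ t ∈ Icc a b, ∀ s ∈ Icc a b, t ≤ s →
      y t ^ 2 ≤ Real.exp (-(2 * (k / b) * (s - t))) * y s ^ 2 := by
  obtain ⟨hzc, hyd, hzd⟩ := decay_z ha hy hode
  set z : ℝ → ℝ := fun r => r * deriv y r with hz
  have hyc : Continuous y := hy.continuous
  have hyd' : ∀ r ∈ Ioo a b, HasDerivAt y (z r / r) r := fun r hr => by
    have hr0 : 0 < r := by linarith [hr.1]
    have : z r / r = deriv y r := by simp only [hz]; field_simp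
    rw [this]; exact hyd r
  have hE : MonotoneOn (fun r => y r * z r) (Icc a b) := by
    refine mono_of_hd (hyc.mul hzc) (fun r hr => (hyd' r hr).mul (hzd r hr)) fun r hr => ?_
    have hr0 : 0 < r := by linarith [hr.1]
    have hq' := hq r hr
    have : 0 ≤ q r := by nlinarith [sq_nonneg k]
    have e : z r / r * z r + y r * (q r / r * y r) = (z r ^ 2 + q r * y r ^ 2) / r := by
      field_simp
    rw [e]; positivity
  have hE0 : ∀ r ∈ Icc a b, 0 ≤ y r * z r := fun r hr => by
    have := hE (left_mem_Icc.2 hab) hr hr.1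
    simpa [h0] using this
  have hF : MonotoneOn (fun r => z r ^ 2 - k ^ 2 * y r ^ 2) (Icc a b) := by
    refine mono_of_hd ((hzc.pow 2).sub ((hyc.pow 2).const_mul _))
      (fun r hr => ((hzd r hr).pow 2).sub (((hyd' r hr).pow 2).const_mul _)) fun r hr => ?_
    have hr0 : 0 < r := by linarith [hr.1]
    have hq' := hq r hr
    have h1 := hE0 r (Ioo_subset_Icc_self hr)
    have e : 2 * (y r * z r) * (q r - k ^ 2) / r ≥ 0 :=
      div_nonneg (mul_nonneg (by linarith) (by linarith)) hr0.le
    refine e.le.trans (le_of_eq ?_)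
    simp only [Nat.cast_ofNat, Nat.add_one_sub_one, pow_one]
    field_simp
  have hF0 : ∀ r ∈ Icc a b, k ^ 2 * y r ^ 2 ≤ z r ^ 2 := fun r hr => by
    have := hF (left_mem_Icc.2 hab) hr hr.1
    simp only [h0] at this
    nlinarith [sq_nonneg (z a)]
  have hEk : ∀ r ∈ Icc a b, k * y r ^ 2 ≤ y r * z r := fun r hr => by
    apply le_of_sq_le_sq_aux _ (hE0 r hr)
    nlinarith [hF0 r hr, mul_le_mul_of_nonneg_left (hF0 r hr) (sq_nonneg (y r))]
  have hG : MonotoneOn (fun r => Real.exp (-(2 * (k / b) * r)) * y r ^ 2) (Icc a b) := by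
    refine mono_of_hd (by fun_prop) (f' := fun r => Real.exp (-(2 * (k / b) * r)) * -(2 * (k / b) * 1) * y r ^ 2
      + Real.exp (-(2 * (k / b) * r)) * (2 * y r * (z r / r)))
      (fun r hr => ?_) fun r hr => ?_
    · have h1 := (((hasDerivAt_id r).const_mul (2 * (k / b))).neg).exp
      have h2 := (hyd' r hr).pow 2
      have := h1.mul h2
      convert! this using 1
      simp
    · have hr0 : 0 < r := by linarith [hr.1]
      have hb0 : 0 < b := by linarith
      have h1 := hEk r (Ioo_subset_Icc_self hr)
      have h2 : k / b * y r ^ 2 ≤ y r * (z r / r) := by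
        calc k / b * y r ^ 2 = k * y r ^ 2 / b := by ring
          _ ≤ k * y r ^ 2 / r := by have := hr.2.le; gcongr
          _ ≤ y r * z r / r := by gcongr
          _ = _ := by ring
      have h3 := mul_nonneg (Real.exp_pos (-(2 * (k / b) * r))).le (sub_nonneg.2 h2)
      linarith
  intro t ht s hs hts
  have h1 := hG ht hs hts
  simp only at h1
  have h2 := mul_le_mul_of_nonneg_left h1 (Real.exp_pos (2 * (k / b) * t)).le
  rw [← mul_assoc, ← mul_assoc, ← Real.exp_add, ← Real.exp_add] at h2
  rw [show 2 * (k / b) * t + -(2 * (k / b) * t) = 0 by ring,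
    show 2 * (k / b) * t + -(2 * (k / b) * s) = -(2 * (k / b) * (s - t)) by ring] at h2
  simpa using h2

lemma decay_out {a b k : ℝ} {y q : ℝ → ℝ} (ha : 0 < a) (hab : a ≤ b) (hk : 0 ≤ k)
    (hy : ContDiff ℝ 2 y)
    (hode : ∀ r ∈ Ioo a b, deriv (deriv y) r + (1 / r) * deriv y r = q r / r ^ 2 * y r)
    (hq : ∀ r ∈ Ioo a b, k ^ 2 ≤ q r) (h0 : y b = 0) :
    ∀ t ∈ Icc a b, ∀ s ∈ Icc a b, s ≤ t →
      y t ^ 2 ≤ Real.exp (-(2 * (k / b) * (t - s))) * y s ^ 2 := by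
  obtain ⟨hzc, hyd, hzd⟩ := decay_z ha hy hode
  set z : ℝ → ℝ := fun r => r * deriv y r with hz
  have hyc : Continuous y := hy.continuous
  have hyd' : ∀ r ∈ Ioo a b, HasDerivAt y (z r / r) r := fun r hr => by
    have hr0 : 0 < r := by linarith [hr.1]
    have : z r / r = deriv y r := by simp only [hz]; field_simp
    rw [this]; exact hyd r
  have hE : MonotoneOn (fun r => y r * z r) (Icc a b) := by
    refine mono_of_hd (hyc.mul hzc) (fun r hr => (hyd' r hr).mul (hzd r hr)) fun r hr => ?_
    have hr0 : 0 < r := by linarith [hr.1]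
    have hq' := hq r hr
    have : 0 ≤ q r := by nlinarith [sq_nonneg k]
    have e : z r / r * z r + y r * (q r / r * y r) = (z r ^ 2 + q r * y r ^ 2) / r := by
      field_simp
    rw [e]; positivity
  have hE0 : ∀ r ∈ Icc a b, y r * z r ≤ 0 := fun r hr => by
    have := hE hr (right_mem_Icc.2 hab) hr.2
    simpa [h0] using this
  have hF : AntitoneOn (fun r => z r ^ 2 - k ^ 2 * y r ^ 2) (Icc a b) := by
    refine anti_of_hd ((hzc.pow 2).sub ((hyc.pow 2).const_mul _))
      (fun r hr => ((hzd r hr).pow 2).sub (((hyd' r hr).pow 2).const_mul _)) fun r hr => ?_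
    have hr0 : 0 < r := by linarith [hr.1]
    have hq' := hq r hr
    have h1 := hE0 r (Ioo_subset_Icc_self hr)
    have e : 2 * (y r * z r) * (q r - k ^ 2) / r ≤ 0 :=
      div_nonpos_of_nonpos_of_nonneg
        (mul_nonpos_of_nonpos_of_nonneg (by linarith) (by linarith)) hr0.le
    refine le_trans (le_of_eq ?_) e
    simp only [Nat.cast_ofNat, Nat.add_one_sub_one, pow_one]
    field_simp
  have hF0 : ∀ r ∈ Icc a b, k ^ 2 * y r ^ 2 ≤ z r ^ 2 := fun r hr => by
    have := hF hr (right_mem_Icc.2 hab) hr.2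
    simp only [h0] at this
    nlinarith [sq_nonneg (z b)]
  have hEk : ∀ r ∈ Icc a b, k * y r ^ 2 ≤ -(y r * z r) := fun r hr => by
    apply le_of_sq_le_sq_aux _ (by linarith [hE0 r hr])
    nlinarith [hF0 r hr, mul_le_mul_of_nonneg_left (hF0 r hr) (sq_nonneg (y r))]
  have hG : AntitoneOn (fun r => Real.exp (2 * (k / b) * r) * y r ^ 2) (Icc a b) := by
    refine anti_of_hd (by fun_prop) (f' := fun r => Real.exp (2 * (k / b) * r) * (2 * (k / b) * 1) * y r ^ 2
      + Real.exp (2 * (k / b) * r) * (2 * y r * (z r / r)))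
      (fun r hr => ?_) fun r hr => ?_
    · have h1 := ((hasDerivAt_id r).const_mul (2 * (k / b))).exp
      have h2 := (hyd' r hr).pow 2
      have := h1.mul h2
      convert! this using 1
      simp
    · have hr0 : 0 < r := by linarith [hr.1]
      have hb0 : 0 < b := by linarith
      have h1 := hEk r (Ioo_subset_Icc_self hr)
      have h2 : k / b * y r ^ 2 ≤ -(y r * (z r / r)) := by
        calc k / b * y r ^ 2 = k * y r ^ 2 / b := by ring
          _ ≤ k * y r ^ 2 / r := by have := hr.2.le; gcongr
          _ ≤ -(y r * z r) / r := by gcongr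
          _ = _ := by ring
      have h3 := mul_nonneg (Real.exp_pos (2 * (k / b) * r)).le (sub_nonneg.2 h2)
      linarith
  intro t ht s hs hts
  have h1 := hG hs ht hts
  simp only at h1
  have h2 := mul_le_mul_of_nonneg_left h1 (Real.exp_pos (-(2 * (k / b) * t))).le
  rw [← mul_assoc, ← mul_assoc, ← Real.exp_add, ← Real.exp_add] at h2
  rw [show -(2 * (k / b) * t) + 2 * (k / b) * t = 0 by ring,
    show -(2 * (k / b) * t) + 2 * (k / b) * s = -(2 * (k / b) * (t - s)) by ring] at h2
  simpa using h2

lemma EigP.smul {R₀ R₁ R₂ cm cp l : ℝ} {n : ℕ} {f g : ℝ → ℝ} (h : EigP R₀ R₁ R₂ cm cp n l f g)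
    (c : ℝ) (hc : c ≠ 0) :
    EigP R₀ R₁ R₂ cm cp n l (fun r => c * f r) (fun r => c * g r) := by
  obtain ⟨h1, h2, h3, h4, h5, h6, h7, h8, r, hr, hfr⟩ := h
  have e : ∀ f : ℝ → ℝ, deriv (fun r => c * f r) = fun r => c * deriv f r := fun f => by
    funext r
    exact deriv_const_mul_field c
  refine ⟨contDiff_const.mul h1, contDiff_const.mul h2, by simp [h3], by simp [h4],
    by simp [h5], ?_, ?_, ?_, r, hr, mul_ne_zero hc hfr⟩
  · rw [e, e]
    linear_combination c * h6
  · intro r hr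
    rw [e, e]
    linear_combination c * h7 r hr
  · intro r hr
    rw [e, e]
    linear_combination c * h8 r hr

lemma annulus_compact (R₀ R₂ : ℝ) : IsCompact {z : ℂ | R₀ ≤ ‖z‖ ∧ ‖z‖ ≤ R₂} := by
  apply Metric.isCompact_of_isClosed_isBounded
  · exact (isClosed_le continuous_const continuous_norm).inter
      (isClosed_le continuous_norm continuous_const)
  · apply (Metric.isBounded_closedBall (x := (0 : ℂ)) (r := R₂)).subset
    intro z hz
    simpa using hz.2

lemma annulus_pos {p q : ℝ} (hp : 0 ≤ p) (hpq : p < q) :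
    0 < (volume {z : ℂ | p ≤ ‖z‖ ∧ ‖z‖ ≤ q}).toReal := by
  apply ENNReal.toReal_pos
  · have ho : IsOpen {z : ℂ | p < ‖z‖ ∧ ‖z‖ < q} :=
      (isOpen_lt continuous_const continuous_norm).inter
      (isOpen_lt continuous_norm continuous_const)
    have hne : {z : ℂ | p < ‖z‖ ∧ ‖z‖ < q}.Nonempty := by
      refine ⟨(((p + q) / 2 : ℝ) : ℂ), ?_⟩
      have : ‖(((p + q) / 2 : ℝ) : ℂ)‖ = (p + q) / 2 := by
        rw [Complex.norm_real, Real.norm_of_nonneg (by linarith)]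
      constructor <;> rw [this] <;> linarith
    have h1 := ho.measure_pos volume hne
    have h2 : volume {z : ℂ | p < ‖z‖ ∧ ‖z‖ < q} ≤ volume {z : ℂ | p ≤ ‖z‖ ∧ ‖z‖ ≤ q} :=
      measure_mono fun z hz => ⟨hz.1.le, hz.2.le⟩
    exact (lt_of_lt_of_le h1 h2).ne'
  · exact (annulus_compact p q).measure_lt_top.ne

lemma avg_bound {H : ℂ → ℝ} (hH : Continuous H) (hH0 : ∀ z, 0 ≤ H z) {A M : Set ℂ}
    (hA : IsCompact A) (hM : IsCompact M) (hAM : A ⊆ M) (h1 : ∫ z in M, H z = 1)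
    {c e : ℝ} (he : 0 ≤ e) (hc : ∀ z ∈ A, c ≤ e * H z) :
    c * (volume A).toReal ≤ e := by
  have hi : ∀ {B : Set ℂ}, IsCompact B → IntegrableOn H B volume :=
    fun hB => hH.continuousOn.integrableOn_compact hB
  have h2 : ∫ z in A, c ≤ ∫ z in A, e * H z := by
    apply setIntegral_mono_on _ ((hi hA).const_mul e) hA.measurableSet hc
    exact continuousOn_const.integrableOn_compact hA
  rw [setIntegral_const, integral_const_mul] at h2
  have h3 : ∫ z in A, H z ≤ ∫ z in M, H z :=
    setIntegral_mono_set (hi hM) (Eventually.of_forall hH0) (Eventually.of_forall hAM)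
  rw [h1] at h3
  have h4 : (volume A).toReal * c ≤ e * ∫ z in A, H z := by simpa [Measure.real] using h2
  nlinarith

lemma EigP.odes {R₀ R₁ R₂ cm cp l : ℝ} {n : ℕ} {f g : ℝ → ℝ} (hR₀ : 0 < R₀) (h01 : R₀ < R₁)
    (hcm : 0 < cm) (hcp : 0 < cp)
    (h : EigP R₀ R₁ R₂ cm cp n l f g) :
    (∀ r ∈ Ioo R₀ R₁, deriv (deriv f) r + (1 / r) * deriv f r
      = ((n : ℝ) ^ 2 - l * r ^ 2 / cm) / r ^ 2 * f r) ∧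
    (∀ r ∈ Ioo R₁ R₂, deriv (deriv g) r + (1 / r) * deriv g r
      = ((n : ℝ) ^ 2 - l * r ^ 2 / cp) / r ^ 2 * g r) := by
  obtain ⟨h1, h2, h3, h4, h5, h6, h7, h8, -⟩ := h
  constructor
  · intro r hr
    have hr0 : 0 < r := by linarith [hr.1]
    have h := h7 r hr
    have e : deriv (deriv f) r + (1 / r) * deriv f r
      = ((cm * (n : ℝ) ^ 2 / r ^ 2) * f r - l * f r) / cm := by
      rw [eq_div_iff hcm.ne']; linarith
    rw [e]; field_simp
  · intro r hr
    have hr0 : 0 < r := by linarith [hr.1]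
    have h := h8 r hr
    have e : deriv (deriv g) r + (1 / r) * deriv g r
      = ((cp * (n : ℝ) ^ 2 / r ^ 2) * g r - l * g r) / cp := by
      rw [eq_div_iff hcp.ne']; linarith
    rw [e]; field_simp

lemma pw_bound {R₀ R₁ R₂ cm cp l k ε v : ℝ} {n : ℕ} {f g : ℝ → ℝ} (hR₀ : 0 < R₀) (h01 : R₀ < R₁)
    (h12 : R₁ < R₂) (hcm : 0 < cm) (hcp : 0 < cp)
    (h : EigP R₀ R₁ R₂ cm cp n l f g) (hk : 0 ≤ k)
    (hε : 0 < ε) (hε1 : ε ≤ R₁ - R₀) (hε2 : ε ≤ R₂ - R₁)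
    (hqm : ∀ r ∈ Ioo R₀ (R₁ - ε / 4), k ^ 2 ≤ (n : ℝ) ^ 2 - l * r ^ 2 / cm)
    (hqp : ∀ r ∈ Ioo R₁ R₂, k ^ 2 ≤ (n : ℝ) ^ 2 - l * r ^ 2 / cp)
    (hc : Continuous fun z : ℂ => (if ‖z‖ ≤ R₁ then f ‖z‖ else g ‖z‖) ^ 2)
    (hnorm : ∫ z in {z : ℂ | R₀ ≤ ‖z‖ ∧ ‖z‖ ≤ R₂}, (if ‖z‖ ≤ R₁ then f ‖z‖ else g ‖z‖) ^ 2 = 1)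
    (hv : 0 < v)
    (hv1 : v ≤ (volume {z : ℂ | R₁ - ε / 2 ≤ ‖z‖ ∧ ‖z‖ ≤ R₁ - ε / 4}).toReal)
    (hv2 : v ≤ (volume {z : ℂ | R₁ + ε / 4 ≤ ‖z‖ ∧ ‖z‖ ≤ R₁ + ε / 2}).toReal)
    (t : ℝ) (ht0 : R₀ ≤ t) (ht2 : t ≤ R₂) (hd : ε ≤ |t - R₁|) :
    (if t ≤ R₁ then f t else g t) ^ 2 ≤ Real.exp (-(k * ε / R₂)) / v := by
  obtain ⟨o1, o2⟩ := h.odes hR₀ h01 hcm hcp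
  obtain ⟨h1, h2, h3, h4, h5, h6, -, -, -⟩ := h
  have hR₁ : 0 < R₁ := by linarith
  have hR₂ : 0 < R₂ := by linarith
  rw [le_div_iff₀ hv]
  have main : ∃ A : Set ℂ, IsCompact A ∧ A ⊆ {z : ℂ | R₀ ≤ ‖z‖ ∧ ‖z‖ ≤ R₂} ∧
      v ≤ (volume A).toReal ∧
      ∀ z ∈ A, (if t ≤ R₁ then f t else g t) ^ 2 ≤
        Real.exp (-(k * ε / R₂)) * (if ‖z‖ ≤ R₁ then f ‖z‖ else g ‖z‖) ^ 2 := by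
    rcases le_total t R₁ with htl | htl
    · rw [abs_of_nonpos (by linarith)] at hd
      refine ⟨_, annulus_compact _ _, fun z hz => ⟨?_, ?_⟩, hv1, fun z hz => ?_⟩
      · linarith [hz.1]
      · linarith [hz.2]
      · have hz1 : ‖z‖ ≤ R₁ := by linarith [hz.2]
        rw [if_pos htl, if_pos hz1]
        have := decay_in (b := R₁ - ε / 4) hR₀ (by linarith) hk h1
          (fun r hr => o1 r ⟨hr.1, by linarith [hr.2]⟩) hqm h3 t ⟨ht0, by linarith⟩ ‖z‖
          ⟨by linarith [hz.1], hz.2⟩ (by linarith [hz.1])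
        refine this.trans ?_
        apply mul_le_mul_of_nonneg_right _ (sq_nonneg _)
        apply Real.exp_le_exp.2
        apply neg_le_neg
        have hb : 0 < R₁ - ε / 4 := by linarith
        have hzt : ε / 2 ≤ ‖z‖ - t := by linarith [hz.1]
        calc k * ε / R₂ = 2 * (k / R₂) * (ε / 2) := by ring
          _ ≤ 2 * (k / (R₁ - ε / 4)) * (‖z‖ - t) := by
            have : R₁ - ε / 4 ≤ R₂ := by linarith
            gcongr
    · rw [abs_of_nonneg (by linarith)] at hd
      refine ⟨_, annulus_compact _ _, fun z hz => ⟨?_, ?_⟩, hv2, fun z hz => ?_⟩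
      · linarith [hz.1]
      · linarith [hz.2]
      · have hz1 : ¬ ‖z‖ ≤ R₁ := by push Not; linarith [hz.1]
        have ht1 : ¬ t ≤ R₁ := by push Not; linarith
        rw [if_neg ht1, if_neg hz1]
        have := decay_out (a := R₁) hR₁ h12.le hk h2 o2 hqp h4 t ⟨by linarith, ht2⟩ ‖z‖
          ⟨by linarith [hz.1], by linarith [hz.2]⟩ (by linarith [hz.2])
        refine this.trans ?_
        apply mul_le_mul_of_nonneg_right _ (sq_nonneg _)
        apply Real.exp_le_exp.2
        apply neg_le_neg
        have hzt : ε / 2 ≤ t - ‖z‖ := by linarith [hz.2]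
        calc k * ε / R₂ = 2 * (k / R₂) * (ε / 2) := by ring
          _ ≤ 2 * (k / R₂) * (t - ‖z‖) := by gcongr
  obtain ⟨A, hA, hAM, hvA, hAb⟩ := main
  have := avg_bound hc (fun z => sq_nonneg _) hA (annulus_compact _ _) hAM hnorm
    (Real.exp_pos _).le hAb
  exact (mul_le_mul_of_nonneg_left hvA (sq_nonneg _)).trans this

lemma EigP.cont {R₀ R₁ R₂ cm cp l : ℝ} {n : ℕ} {f g : ℝ → ℝ}
    (h : EigP R₀ R₁ R₂ cm cp n l f g) :
    Continuous fun z : ℂ => (if ‖z‖ ≤ R₁ then f ‖z‖ else g ‖z‖) := by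
  obtain ⟨h1, h2, h3, h4, h5, -⟩ := h
  refine Continuous.if_le (h1.continuous.comp continuous_norm) (h2.continuous.comp continuous_norm)
    continuous_norm continuous_const fun z hz => ?_
  simp only [Function.comp, hz, h5]

lemma EigP.normalize {R₀ R₁ R₂ cm cp l : ℝ} {n : ℕ} {f g : ℝ → ℝ} (hR₀ : 0 < R₀)
    (h12 : R₁ < R₂) (h : EigP R₀ R₁ R₂ cm cp n l f g) :
    ∃ f g, EigP R₀ R₁ R₂ cm cp n l f g ∧
      ∫ z in {z : ℂ | R₀ ≤ ‖z‖ ∧ ‖z‖ ≤ R₂}, (if ‖z‖ ≤ R₁ then f ‖z‖ else g ‖z‖) ^ 2 = 1 := by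
  set W := ∫ z in {z : ℂ | R₀ ≤ ‖z‖ ∧ ‖z‖ ≤ R₂}, (if ‖z‖ ≤ R₁ then f ‖z‖ else g ‖z‖) ^ 2 with hW
  have hc := h.cont
  have hWpos : 0 < W := by
    rw [hW, setIntegral_pos_iff_support_of_nonneg_ae (Eventually.of_forall fun z => sq_nonneg _)
      ((hc.pow 2).continuousOn.integrableOn_compact (annulus_compact _ _))]
    obtain ⟨h1, -, -, -, -, -, -, -, r, hr, hfr⟩ := h
    have ho : IsOpen ({z : ℂ | R₀ < ‖z‖} ∩ ({z : ℂ | ‖z‖ < R₁} ∩ {z : ℂ | f ‖z‖ ≠ 0})) :=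
      (isOpen_lt continuous_const continuous_norm).inter
      ((isOpen_lt continuous_norm continuous_const).inter
        (isOpen_ne_fun (h1.continuous.comp continuous_norm) continuous_const))
    have hrn : ‖(r : ℂ)‖ = r := by
      rw [Complex.norm_real, Real.norm_of_nonneg (by linarith [hr.1])]
    refine lt_of_lt_of_le (ho.measure_pos volume ⟨(r : ℂ), ?_, ?_, ?_⟩) (measure_mono ?_)
    · change R₀ < ‖(r : ℂ)‖; rw [hrn]; exact hr.1
    · change ‖(r : ℂ)‖ < R₁; rw [hrn]; exact hr.2
    · change f ‖(r : ℂ)‖ ≠ 0; rw [hrn]; exact hfr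
    · rintro z ⟨hz1, hz2, hz3⟩
      simp only [mem_setOf_eq] at hz1 hz2 hz3
      refine ⟨?_, hz1.le, by linarith⟩
      simp only [Function.mem_support]
      rw [if_pos hz2.le]
      exact pow_ne_zero 2 hz3
  have hsq : 0 < Real.sqrt W := Real.sqrt_pos.2 hWpos
  refine ⟨_, _, h.smul (Real.sqrt W)⁻¹ (by positivity), ?_⟩
  have e : ∀ z : ℂ, (if ‖z‖ ≤ R₁ then (Real.sqrt W)⁻¹ * f ‖z‖ else (Real.sqrt W)⁻¹ * g ‖z‖) ^ 2
      = W⁻¹ * (if ‖z‖ ≤ R₁ then f ‖z‖ else g ‖z‖) ^ 2 := by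
    intro z
    have : ((Real.sqrt W)⁻¹) ^ 2 = W⁻¹ := by rw [inv_pow, Real.sq_sqrt hWpos.le]
    split_ifs <;> rw [mul_pow, this]
  simp only [e]
  have hW0 := hWpos.ne'
  rw [integral_const_mul, ← hW, inv_mul_cancel₀ hW0]

/-- Main theorem (annulus): on `M = {R₀ ≤ |z| ≤ R₂} ⊆ ℂ ≃ ℝ²` with interface
`S = {|z| = R₁}` and piecewise constant `c` with `0 < c₋ < c₊`,
`c₋/R₁² < c₊/R₂²`, there are eigenfunctions `u_n(re^{iθ}) = e^{inθ} ψ_n(r)` of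
`−div(c∇·)` (Dirichlet + transmission conditions, the radial parts `ψm, ψp`
being the restrictions of `ψ_n` to the two subannuli) with eigenvalues
`λ_n ∼ E₀ n²`, normalized in `L²(M)`, and exponentially small on every compact
`ω ⊆ M` with `dist(ω, S) > 0`. -/
theorem stmt_18 (R₀ R₁ R₂ cm cp : ℝ)
    (hR₀ : 0 < R₀) (hR₀₁ : R₀ < R₁) (hR₁₂ : R₁ < R₂)
    (hcm : 0 < cm) (hcmp : cm < cp)
    (hjump : cm / R₁ ^ 2 < cp / R₂ ^ 2) :
    ∃ (lam : ℕ → ℝ) (ψm ψp : ℕ → ℝ → ℝ) (u : ℕ → ℂ → ℂ),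
      (∀ n : ℕ,
        -- radial regularity and membership of u_n in the domain 𝒜 :
        ContDiff ℝ 2 (ψm n) ∧ ContDiff ℝ 2 (ψp n) ∧
        ψm n R₀ = 0 ∧ ψp n R₂ = 0 ∧ ψm n R₁ = ψp n R₁ ∧
        cp * deriv (ψm n) R₁ = cm * deriv (ψp n) R₁ ∧
        -- u_n in polar coordinates : u_n(re^{iθ}) = e^{inθ} ψ_n(r) :
        (∀ z : ℂ, u n z =
          (z / (‖z‖ : ℂ)) ^ n *
            ((if ‖z‖ ≤ R₁ then ψm n ‖z‖ else ψp n ‖z‖ : ℝ) : ℂ)) ∧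
        -- the eigenvalue equation −div(c ∇ u_n) = λ_n u_n, written radially :
        (∀ r ∈ Ioo R₀ R₁,
          -cm * (deriv (deriv (ψm n)) r + (1 / r) * deriv (ψm n) r) +
            (cm * (n : ℝ) ^ 2 / r ^ 2) * ψm n r = lam n * ψm n r) ∧
        (∀ r ∈ Ioo R₁ R₂,
          -cp * (deriv (deriv (ψp n)) r + (1 / r) * deriv (ψp n) r) +
            (cp * (n : ℝ) ^ 2 / r ^ 2) * ψp n r = lam n * ψp n r) ∧
        -- normalization ‖u_n‖_{L²(M)} = 1 :
        (∫ z in {z : ℂ | R₀ ≤ ‖z‖ ∧ ‖z‖ ≤ R₂}, ‖u n z‖ ^ 2) = 1) ∧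
      -- λ_n ∼ E₀ n² :
      Tendsto (fun n : ℕ => lam n / (n : ℝ) ^ 2) atTop (nhds (cm / R₁ ^ 2)) ∧
      -- exponential smallness away from the interface S = {|z| = R₁} :
      (∀ ω : Set ℂ, IsCompact ω → ω ⊆ {z : ℂ | R₀ ≤ ‖z‖ ∧ ‖z‖ ≤ R₂} →
        (∃ ε > 0, ∀ x ∈ ω, ∀ y ∈ Metric.sphere (0 : ℂ) R₁, ε ≤ dist x y) →
        ∃ C > 0, ∃ d > 0, ∀ n : ℕ,
          (∫ z in ω, ‖u n z‖ ^ 2) ≤ (C * Real.exp (-d * n)) ^ 2) := by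
  have hcp : 0 < cp := by linarith
  have hR₁ : 0 < R₁ := by linarith
  have hR₂ : 0 < R₂ := by linarith
  obtain ⟨lam, hex, hlim⟩ := eigen_seq hR₀ hR₀₁ hR₁₂ hcm hcp hjump
  have hex' : ∀ n, ∃ f g, EigP R₀ R₁ R₂ cm cp n (lam n) f g ∧
      ∫ z in {z : ℂ | R₀ ≤ ‖z‖ ∧ ‖z‖ ≤ R₂}, (if ‖z‖ ≤ R₁ then f ‖z‖ else g ‖z‖) ^ 2 = 1 := by
    intro n
    obtain ⟨f, g, h⟩ := hex n
    exact h.normalize hR₀ hR₁₂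
  choose ψm ψp hE hN using hex'
  have hnu : ∀ n : ℕ, ∀ z : ℂ, R₀ ≤ ‖z‖ →
      ‖(z / (‖z‖ : ℂ)) ^ n * ((if ‖z‖ ≤ R₁ then ψm n ‖z‖ else ψp n ‖z‖ : ℝ) : ℂ)‖ ^ 2
        = (if ‖z‖ ≤ R₁ then ψm n ‖z‖ else ψp n ‖z‖) ^ 2 := by
    intro n z hz
    have hz0 : ‖z‖ ≠ 0 := by linarith
    rw [norm_mul, norm_pow, norm_div, Complex.norm_real, Complex.norm_real, norm_norm,
      div_self hz0, one_pow, one_mul, Real.norm_eq_abs, sq_abs]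
  have hMm : MeasurableSet {z : ℂ | R₀ ≤ ‖z‖ ∧ ‖z‖ ≤ R₂} := (annulus_compact _ _).measurableSet
  refine ⟨lam, ψm, ψp, fun n z => (z / (‖z‖ : ℂ)) ^ n *
            ((if ‖z‖ ≤ R₁ then ψm n ‖z‖ else ψp n ‖z‖ : ℝ) : ℂ), ?_, hlim, ?_⟩
  · intro n
    obtain ⟨h1, h2, h3, h4, h5, h6, h7, h8, -⟩ := hE n
    refine ⟨h1, h2, h3, h4, h5, h6, fun z => rfl, h7, h8, ?_⟩
    rw [← hN n]
    exact setIntegral_congr_fun hMm fun z hz => hnu n z hz.1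
  · intro ω hω hωM hdist
    obtain ⟨ε₀, hε₀, hdist⟩ := hdist
    set ε := min ε₀ (min (R₁ - R₀) (R₂ - R₁)) with hεd
    have hε : 0 < ε := lt_min hε₀ (lt_min (by linarith) (by linarith))
    have hε1 : ε ≤ R₁ - R₀ := (min_le_right _ _).trans (min_le_left _ _)
    have hε2 : ε ≤ R₂ - R₁ := (min_le_right _ _).trans (min_le_right _ _)
    have hsep : ∀ z ∈ ω, ε ≤ |‖z‖ - R₁| := by
      intro z hz
      have hz0 : 0 < ‖z‖ := lt_of_lt_of_le hR₀ (hωM hz).1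
      have hzne : (‖z‖ : ℂ) ≠ 0 := by exact_mod_cast hz0.ne'
      have h1 := hdist z hz (((R₁ / ‖z‖ : ℝ) : ℂ) * z) (by
        rw [mem_sphere_zero_iff_norm, norm_mul, Complex.norm_real,
          Real.norm_of_nonneg (by positivity)]
        field_simp)
      have h2 : dist z (((R₁ / ‖z‖ : ℝ) : ℂ) * z) = |‖z‖ - R₁| := by
        have e : z - ((R₁ / ‖z‖ : ℝ) : ℂ) * z = (((‖z‖ - R₁) / ‖z‖ : ℝ) : ℂ) * z := by
          push_cast
          field_simp
        rw [dist_eq_norm, e, norm_mul, Complex.norm_real, Real.norm_eq_abs, abs_div,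
          abs_of_pos hz0]
        field_simp
      rw [h2] at h1
      exact (min_le_left _ _).trans h1
    -- the classically forbidden regions
    set s₁ := R₁ - ε / 4 with hs₁
    have hs₁0 : 0 < s₁ := by linarith
    have hm1 : s₁ ^ 2 / R₁ ^ 2 < 1 := by
      rw [div_lt_one (by positivity)]
      have : s₁ < R₁ := by linarith
      gcongr
    have hm2 : cm / R₁ ^ 2 * (R₂ ^ 2 / cp) < 1 := by
      calc cm / R₁ ^ 2 * (R₂ ^ 2 / cp) < cp / R₂ ^ 2 * (R₂ ^ 2 / cp) := by gcongr
        _ = 1 := by field_simp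
    set e := min (1 - s₁ ^ 2 / R₁ ^ 2) (1 - cm / R₁ ^ 2 * (R₂ ^ 2 / cp)) / 2 with he
    have hmin : 0 < min (1 - s₁ ^ 2 / R₁ ^ 2) (1 - cm / R₁ ^ 2 * (R₂ ^ 2 / cp)) :=
      lt_min (by linarith) (by linarith)
    have hepos : 0 < e := by positivity
    have he1 : s₁ ^ 2 / R₁ ^ 2 < 1 - e := by
      have := min_le_left (1 - s₁ ^ 2 / R₁ ^ 2) (1 - cm / R₁ ^ 2 * (R₂ ^ 2 / cp))
      linarith
    have he2 : cm / R₁ ^ 2 * (R₂ ^ 2 / cp) < 1 - e := by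
      have := min_le_right (1 - s₁ ^ 2 / R₁ ^ 2) (1 - cm / R₁ ^ 2 * (R₂ ^ 2 / cp))
      linarith
    have hlim1 := hlim.mul_const (s₁ ^ 2 / cm)
    have hlim2 := hlim.mul_const (R₂ ^ 2 / cp)
    have he1' : cm / R₁ ^ 2 * (s₁ ^ 2 / cm) < 1 - e := by
      have : cm / R₁ ^ 2 * (s₁ ^ 2 / cm) = s₁ ^ 2 / R₁ ^ 2 := by field_simp
      rw [this]; exact he1
    have hE0 : 0 < cm / R₁ ^ 2 := by positivity
    have hev := ((hlim1.eventually (gt_mem_nhds he1')).and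
      (hlim2.eventually (gt_mem_nhds he2))).and ((hlim.eventually (lt_mem_nhds hE0)).and
        (eventually_gt_atTop 0))
    obtain ⟨N, hNN⟩ := eventually_atTop.1 hev
    set v := min (volume {z : ℂ | R₁ - ε / 2 ≤ ‖z‖ ∧ ‖z‖ ≤ R₁ - ε / 4}).toReal
      (volume {z : ℂ | R₁ + ε / 4 ≤ ‖z‖ ∧ ‖z‖ ≤ R₁ + ε / 2}).toReal with hv
    have hvpos : 0 < v := lt_min (annulus_pos (by linarith) (by linarith))
      (annulus_pos (by linarith) (by linarith))
    set η := Real.sqrt e with hη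
    have hηpos : 0 < η := Real.sqrt_pos.2 hepos
    set d := η * ε / R₂ / 2 with hd
    have hdpos : 0 < d := by positivity
    set V := (volume ω).toReal / v with hV
    have hV0 : 0 ≤ V := by positivity
    refine ⟨Real.sqrt V + Real.exp (d * N), by positivity, d, hdpos, fun n => ?_⟩
    have heqI : ∫ z in ω, ‖(z / (‖z‖ : ℂ)) ^ n *
            ((if ‖z‖ ≤ R₁ then ψm n ‖z‖ else ψp n ‖z‖ : ℝ) : ℂ)‖ ^ 2
        = ∫ z in ω, (if ‖z‖ ≤ R₁ then ψm n ‖z‖ else ψp n ‖z‖) ^ 2 :=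
      setIntegral_congr_fun hω.measurableSet fun z hz => hnu n z (hωM hz).1
    rw [heqI]
    have hcont : Continuous fun z : ℂ => (if ‖z‖ ≤ R₁ then ψm n ‖z‖ else ψp n ‖z‖) ^ 2 :=
      (hE n).cont.pow 2
    rcases lt_or_ge n N with hn | hn
    · have h1 : ∫ z in ω, (if ‖z‖ ≤ R₁ then ψm n ‖z‖ else ψp n ‖z‖) ^ 2 ≤ 1 := by
        rw [← hN n]
        exact setIntegral_mono_set (hcont.continuousOn.integrableOn_compact (annulus_compact _ _))
          (Eventually.of_forall fun z => sq_nonneg _) (Eventually.of_forall hωM)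
      have h2 : 1 ≤ (Real.sqrt V + Real.exp (d * N)) * Real.exp (-d * n) := by
        have h3 : 1 ≤ Real.exp (d * N) * Real.exp (-d * n) := by
          rw [← Real.exp_add]
          apply Real.one_le_exp
          have : (n : ℝ) ≤ N := by exact_mod_cast hn.le
          nlinarith
        have h4 : 0 ≤ Real.sqrt V * Real.exp (-d * n) := by positivity
        linarith
      nlinarith
    · obtain ⟨⟨g1, g2⟩, g3, g4⟩ := hNN n hn
      have hn0 : (0 : ℝ) < n := by exact_mod_cast g4
      have hn2 : (0 : ℝ) < (n : ℝ) ^ 2 := by positivity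
      have hl0 : 0 < lam n := by
        by_contra! hneg
        have := div_nonpos_of_nonpos_of_nonneg hneg hn2.le
        linarith
      have hk2 : (n * η) ^ 2 = (n : ℝ) ^ 2 * e := by rw [mul_pow, hη, Real.sq_sqrt hepos.le]
      have hpw : ∀ z ∈ ω, (if ‖z‖ ≤ R₁ then ψm n ‖z‖ else ψp n ‖z‖) ^ 2
          ≤ Real.exp (-(n * η * ε / R₂)) / v := by
        intro z hz
        refine pw_bound hR₀ hR₀₁ hR₁₂ hcm hcp (hE n) (by positivity) hε hε1 hε2 ?_ ?_ hcont (hN n)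
          hvpos (min_le_left _ _) (min_le_right _ _) ‖z‖ (hωM hz).1 (hωM hz).2 (hsep z hz)
        · intro r hr
          have hr0 : 0 < r := by linarith [hr.1]
          have h1 : lam n * r ^ 2 / cm ≤ lam n * s₁ ^ 2 / cm := by
            have := hr.2.le
            gcongr
          have h2 : lam n * s₁ ^ 2 / cm = (n : ℝ) ^ 2 * (lam n / (n : ℝ) ^ 2 * (s₁ ^ 2 / cm)) := by
            field_simp
          have h3 := mul_le_mul_of_nonneg_left g1.le hn2.le
          rw [hk2]
          linarith
        · intro r hr
          have hr0 : 0 < r := by linarith [hr.1]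
          have h1 : lam n * r ^ 2 / cp ≤ lam n * R₂ ^ 2 / cp := by
            have := hr.2.le
            gcongr
          have h2 : lam n * R₂ ^ 2 / cp = (n : ℝ) ^ 2 * (lam n / (n : ℝ) ^ 2 * (R₂ ^ 2 / cp)) := by
            field_simp
          have h3 := mul_le_mul_of_nonneg_left g2.le hn2.le
          rw [hk2]
          linarith
      have h1 : ∫ z in ω, (if ‖z‖ ≤ R₁ then ψm n ‖z‖ else ψp n ‖z‖) ^ 2
          ≤ ∫ z in ω, Real.exp (-(n * η * ε / R₂)) / v :=
        setIntegral_mono_on (hcont.continuousOn.integrableOn_compact hω)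
          (continuousOn_const.integrableOn_compact hω) hω.measurableSet hpw
      rw [setIntegral_const] at h1
      have h2 : (volume.real ω) • (Real.exp (-(n * η * ε / R₂)) / v)
          = (Real.sqrt V * Real.exp (-d * n)) ^ 2 := by
        rw [mul_pow, Real.sq_sqrt hV0, ← Real.exp_nat_mul, smul_eq_mul, Measure.real, hV, hd]
        have : ((2 : ℕ) : ℝ) * (-(η * ε / R₂ / 2) * n) = -(n * η * ε / R₂) := by
          push_cast; ring
        rw [this]; ring
      rw [h2] at h1
      refine h1.trans ?_
      have h3 : 0 ≤ Real.exp (d * N) := by positivity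
      gcongr
      linarith
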